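/- arXiv:0905.3662 — 4 statements merged into one kernel-verified Lean document; each statement's English description precedes it below -/
import Mathlib

section
/- For every z ∈ ℂ³, M(conj(z))·M(z) = −‖z‖²·I, where conj(z) = (conj(z₁), conj(z₂), conj(z₃)). Consequently, for z ≠ 0 the matrix M(z) is invertible with M(z)⁻¹ = −‖z‖⁻²·M(conj(z)), and for every ξ ∈ ℂ⁴ one has M(−‖z‖⁻²·conj(z))·(M(z)·ξ) = ξ. Hence the involution [(ξ,W)] ↦ [(W,ξ)] of ℙ(ℂ⁴×ℂ⁴) maps the twistor fiber F_z to the twistor fiber F_{z'}, where z' = −‖z‖⁻²·conj(z); i.e. it covers the conformal inversion z ↦ −‖z‖⁻²·conj(z) of ℝ⁶ ∖ {0}. -/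
open Matrix

/-- The skew-symmetric matrix `M(z)`, `z ∈ ℂ³`, representing Clifford multiplication. -/
noncomputable def Mz (z : Fin 3 → ℂ) : Matrix (Fin 4) (Fin 4) ℂ :=
  !![0, -z 2, -z 1, -z 0;
     z 2, 0, -(starRingEnd ℂ) (z 0), (starRingEnd ℂ) (z 1);
     z 1, (starRingEnd ℂ) (z 0), 0, -(starRingEnd ℂ) (z 2);
     z 0, -(starRingEnd ℂ) (z 1), (starRingEnd ℂ) (z 2), 0]

/-- Entrywise complex conjugation of a vector in `ℂ³`. -/
noncomputable def conjVec (z : Fin 3 → ℂ) : Fin 3 → ℂ := fun i => (starRingEnd ℂ) (z i)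

/-- The conformal inversion `z ↦ −‖z‖⁻²·conj(z)` of `ℝ⁶ ∖ {0}`. -/
noncomputable def invPt (z : Fin 3 → ℂ) : Fin 3 → ℂ :=
  fun i => -(((∑ j, Complex.normSq (z j))⁻¹ : ℝ) : ℂ) * (starRingEnd ℂ) (z i)

/-- The twistor fiber over `z ∈ ℂ³`, as a subset of `ℂ⁸ = ℂ⁴ × ℂ⁴`. -/
noncomputable def twistorFiber (z : Fin 3 → ℂ) : Set ((Fin 4 → ℂ) × (Fin 4 → ℂ)) :=
  {p | ∃ ξ : Fin 4 → ℂ, p = (ξ, (Mz z).mulVec ξ)}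

theorem Mz_conjVec_mul_Mz (z : Fin 3 → ℂ) :
    Mz (conjVec z) * Mz z =
      (-(∑ i, Complex.normSq (z i))) • (1 : Matrix (Fin 4) (Fin 4) ℂ) := by
  ext i j
  rw [← Complex.coe_smul]
  fin_cases i <;> fin_cases j <;>
    simp [Mz, conjVec, Matrix.mul_apply, Fin.sum_univ_succ, Complex.normSq_eq_conj_mul_self] <;>
    ring

theorem sum_normSq_ne_zero {z : Fin 3 → ℂ} (hz : z ≠ 0) :
    ∑ i, Complex.normSq (z i) ≠ 0 := by
  contrapose! hz
  rw [Finset.sum_eq_zero_iff_of_nonneg fun i _ => Complex.normSq_nonneg (z i)] at hz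
  ext1 i
  exact Complex.normSq_eq_zero.mp (hz i (Finset.mem_univ i))

theorem Mz_real_smul (t : ℝ) (z : Fin 3 → ℂ) : Mz (t • z) = t • Mz z := by
  ext i j
  fin_cases i <;> fin_cases j <;> simp [Mz]

theorem invPt_eq_smul (z : Fin 3 → ℂ) :
    invPt z = (-(∑ i, Complex.normSq (z i))⁻¹) • conjVec z := by
  ext1 i
  simp [invPt, conjVec]

theorem Mz_invPt (z : Fin 3 → ℂ) :
    Mz (invPt z) = (-(∑ i, Complex.normSq (z i))⁻¹) • Mz (conjVec z) := by
  rw [invPt_eq_smul, Mz_real_smul]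

theorem Mz_invPt_mul_Mz {z : Fin 3 → ℂ} (hz : z ≠ 0) : Mz (invPt z) * Mz z = 1 := by
  rw [Mz_invPt, smul_mul_assoc, Mz_conjVec_mul_Mz, smul_smul, neg_mul_neg,
    inv_mul_cancel₀ (sum_normSq_ne_zero hz), one_smul]

theorem Mz_mul_Mz_invPt {z : Fin 3 → ℂ} (hz : z ≠ 0) : Mz z * Mz (invPt z) = 1 :=
  mul_eq_one_comm.mp (Mz_invPt_mul_Mz hz)

theorem swap_image_twistorFiber {z : Fin 3 → ℂ} (hz : z ≠ 0) :
    Prod.swap '' twistorFiber z = twistorFiber (invPt z) := by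
  ext p
  constructor
  · rintro ⟨_, ⟨ξ, rfl⟩, rfl⟩
    exact ⟨(Mz z).mulVec ξ, by simp [Mz_invPt_mul_Mz hz]⟩
  · rintro ⟨η, rfl⟩
    exact ⟨_, ⟨(Mz (invPt z)).mulVec η, rfl⟩, by simp [Mz_mul_Mz_invPt hz]⟩

/-- `M(conj z)·M(z) = −‖z‖²·I`; for `z ≠ 0`, `M(z)⁻¹ = −‖z‖⁻²·M(conj z)`,
`M(z')·(M(z)·ξ) = ξ` where `z' = −‖z‖⁻²·conj z`, and the involution `(ξ,W) ↦ (W,ξ)`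
maps the twistor fiber `F_z` onto `F_{z'}`, covering conformal inversion. -/
theorem Mz_inversion :
    (∀ z : Fin 3 → ℂ,
      Mz (conjVec z) * Mz z = (-(∑ i, Complex.normSq (z i))) • (1 : Matrix (Fin 4) (Fin 4) ℂ)) ∧
    (∀ z : Fin 3 → ℂ, z ≠ 0 →
      (Mz z)⁻¹ = (-(∑ i, Complex.normSq (z i))⁻¹) • Mz (conjVec z)) ∧
    (∀ z : Fin 3 → ℂ, z ≠ 0 → ∀ ξ : Fin 4 → ℂ,
      (Mz (invPt z)).mulVec ((Mz z).mulVec ξ) = ξ) ∧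
    (∀ z : Fin 3 → ℂ, z ≠ 0 →
      Prod.swap '' twistorFiber z = twistorFiber (invPt z)) := by
  refine ⟨Mz_conjVec_mul_Mz, fun z hz => ?_, fun z hz ξ => ?_,
    fun z hz => swap_image_twistorFiber hz⟩
  · rw [← Mz_invPt]
    exact Matrix.inv_eq_left_inv (Mz_invPt_mul_Mz hz)
  · rw [Matrix.mulVec_mulVec, Mz_invPt_mul_Mz hz, Matrix.one_mulVec]
end

section
/- Let q : ℂ⁴×ℂ⁴ → ℂ be the quadratic form q(ξ,W) = Σ_{i=1}^{4} ξ_i W_i, and let V ⊆ ℂ⁸ = ℂ⁴×ℂ⁴ be a 3-dimensional complex subspace on which q vanishes identically (so ℙ(V) is a linear ℙ² contained in the twistor quadric). Then either V is contained in some twistor fiber (V ⊆ F_z for some z ∈ ℂ³, or V ⊆ F_∞), or there is exactly one twistor fiber F (among the F_z, z ∈ ℂ³, and F_∞) with dim_ℂ(V ∩ F) = 2, and dim_ℂ(V ∩ F') ≤ 1 for every other twistor fiber F'. -/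
open Matrix Module

/-- The twistor fiber over `z ∈ ℂ³`: the subspace `F_z = {(ξ, M(z)ξ)} ⊆ ℂ⁴ × ℂ⁴`. -/
noncomputable def fiberSub (z : Fin 3 → ℂ) : Submodule ℂ ((Fin 4 → ℂ) × (Fin 4 → ℂ)) :=
  LinearMap.range (LinearMap.prod LinearMap.id (Mz z).mulVecLin)

/-- The twistor fiber over infinity: `F_∞ = {0} × ℂ⁴`. -/
noncomputable def fiberInf : Submodule ℂ ((Fin 4 → ℂ) × (Fin 4 → ℂ)) :=
  Submodule.prod ⊥ ⊤

/-- The collection of all twistor fibers. -/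
noncomputable def twistorFibers : Set (Submodule ℂ ((Fin 4 → ℂ) × (Fin 4 → ℂ))) :=
  {F | F = fiberInf ∨ ∃ z : Fin 3 → ℂ, F = fiberSub z}

open ComplexConjugate

lemma sum_mul_conj_ne_zero {w : Fin 4 → ℂ} (hw : w ≠ 0) : ∑ i, w i * conj (w i) ≠ 0 := by
  have h : ∑ i, w i * conj (w i) = ((∑ i, Complex.normSq (w i) : ℝ) : ℂ) := by
    push_cast
    exact Finset.sum_congr rfl fun i _ => Complex.mul_conj _
  rw [h, Complex.ofReal_ne_zero]
  intro h0
  rw [Finset.sum_eq_zero_iff_of_nonneg fun i _ => Complex.normSq_nonneg _] at h0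
  exact hw (funext fun i => Complex.normSq_eq_zero.1 (h0 i (Finset.mem_univ i)))

/-- Every null vector `(w, y)` with `w ≠ 0` lies in some fiber `F_z`. -/
lemma exists_Mz_mulVec_eq {w y : Fin 4 → ℂ} (hw : w ≠ 0) (h : w ⬝ᵥ y = 0) :
    ∃ z, Mz z *ᵥ w = y := by
  have hS := sum_mul_conj_ne_zero hw
  obtain ⟨S, hSdef⟩ : ∃ S, S = ∑ i, w i * conj (w i) := ⟨_, rfl⟩
  rw [← hSdef] at hS
  have hSc : conj S = S := by
    rw [hSdef, map_sum]
    exact Finset.sum_congr rfl fun i _ => by rw [map_mul, Complex.conj_conj, mul_comm]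
  simp only [dotProduct, Fin.sum_univ_four] at h hSdef
  refine ⟨![(conj (w 0) * y 3 - conj (w 3) * y 0 + w 1 * conj (y 2) - w 2 * conj (y 1)) / S,
    (conj (w 0) * y 2 - conj (w 2) * y 0 + w 3 * conj (y 1) - w 1 * conj (y 3)) / S,
    (conj (w 0) * y 1 - conj (w 1) * y 0 + w 2 * conj (y 3) - w 3 * conj (y 2)) / S], ?_⟩
  ext i
  fin_cases i <;>
    simp [Mz, mulVec, dotProduct, Fin.sum_univ_four, hSc] <;> field_simp
  · linear_combination (-y 0) * hSdef - conj (w 0) * h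
  · linear_combination (-y 1) * hSdef - conj (w 1) * h
  · linear_combination (-y 2) * hSdef - conj (w 2) * h
  · linear_combination (-y 3) * hSdef - conj (w 3) * h

lemma eq_of_Mz_mulVec_eq {z z' : Fin 3 → ℂ} {w : Fin 4 → ℂ} (hw : w ≠ 0)
    (h : Mz z *ᵥ w = Mz z' *ᵥ w) : z = z' := by
  have hS := sum_mul_conj_ne_zero hw
  have h0 := congrFun h 0
  have h1 := congrFun h 1
  have h2 := congrFun h 2
  have h3 := congrFun h 3
  simp only [Fin.sum_univ_four] at hS
  simp [Mz, mulVec, dotProduct, Fin.sum_univ_four] at h0 h1 h2 h3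
  have c1 := congrArg conj h1
  have c2 := congrArg conj h2
  have c3 := congrArg conj h3
  simp only [map_add, map_neg, map_mul, Complex.conj_conj] at c1 c2 c3
  ext i
  apply mul_right_cancel₀ hS
  fin_cases i <;> simp only [Fin.zero_eta, Fin.mk_one, Fin.reduceFinMk, Fin.isValue]
  · linear_combination conj (w 0) * h3 - conj (w 3) * h0 + w 1 * c2 - w 2 * c1
  · linear_combination conj (w 0) * h2 - conj (w 2) * h0 + w 3 * c1 - w 1 * c3
  · linear_combination conj (w 0) * h1 - conj (w 1) * h0 + w 2 * c3 - w 3 * c2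

/-- For skew-symmetric `N` and `w ≠ 0`, some `M(z) - N` maps the hyperplane orthogonal to `w`
into the line spanned by `w`. -/
lemma exists_Mz_mulVec_sub_mem_span {N : Matrix (Fin 4) (Fin 4) ℂ} (hN : Nᵀ = -N)
    {w : Fin 4 → ℂ} (hw : w ≠ 0) :
    ∃ z, ∀ u, u ⬝ᵥ w = 0 → Mz z *ᵥ u - N *ᵥ u ∈ Submodule.span ℂ {w} := by
  have skew (i j) : N j i = -N i j := congrFun (congrFun hN i) j
  have diag (i) : N i i = 0 := self_eq_neg.1 (skew i i)
  obtain ⟨z, hz⟩ := exists_Mz_mulVec_eq (y := ![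
    N 2 3 * w 1 - N 1 3 * w 2 + N 1 2 * w 3,
    -N 2 3 * w 0 + N 0 3 * w 2 - N 0 2 * w 3,
    N 1 3 * w 0 - N 0 3 * w 1 + N 0 1 * w 3,
    -N 1 2 * w 0 + N 0 2 * w 1 - N 0 1 * w 2]) hw (by
      simp [dotProduct, Fin.sum_univ_four]; ring)
  have hS := sum_mul_conj_ne_zero hw
  obtain ⟨S, hSdef⟩ : ∃ S, S = ∑ i, w i * conj (w i) := ⟨_, rfl⟩
  rw [← hSdef] at hS
  simp only [Fin.sum_univ_four] at hSdef
  have h0 := congrFun hz 0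
  have h1 := congrFun hz 1
  have h2 := congrFun hz 2
  have h3 := congrFun hz 3
  simp [Mz, mulVec, dotProduct, Fin.sum_univ_four] at h0 h1 h2 h3
  refine ⟨fun i => conj (z i), fun u hu => Submodule.mem_span_singleton.2
    ⟨(∑ i, conj (w i) * (Mz (fun i => conj (z i)) *ᵥ u - N *ᵥ u) i) / S, ?_⟩⟩
  simp only [dotProduct, Fin.sum_univ_four] at hu
  ext i
  fin_cases i <;>
    simp [Mz, mulVec, dotProduct, Fin.sum_univ_four, skew 0 1, skew 0 2, skew 0 3, skew 1 2,
      skew 1 3, skew 2 3, diag] <;> field_simp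
  · linear_combination (-((-conj (z 2) - N 0 1) * u 1 + (-conj (z 1) - N 0 2) * u 2 + (-conj (z
      0) - N 0 3) * u 3)) * hSdef - ((-conj (z 2) - N 0 1) * conj (w 1) + (-conj (z 1) - N 0 2)
      * conj (w 2) + (-conj (z 0) - N 0 3) * conj (w 3)) * hu
      + (u 1 * conj (w 2) - u 2 * conj (w 1)) * h3
      - (u 1 * conj (w 3) - u 3 * conj (w 1)) * h2
      + (u 2 * conj (w 3) - u 3 * conj (w 2)) * h1
  · linear_combination (-((-(-conj (z 2) - N 0 1)) * u 0 + (-z 0 - N 1 2) * u 2 + (z 1 - N 1 3)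
      * u 3)) * hSdef - ((-(-conj (z 2) - N 0 1)) * conj (w 0) + (-z 0 - N 1 2) * conj (w 2) +
      (z 1 - N 1 3) * conj (w 3)) * hu
      - (u 0 * conj (w 2) - u 2 * conj (w 0)) * h3
      + (u 0 * conj (w 3) - u 3 * conj (w 0)) * h2
      - (u 2 * conj (w 3) - u 3 * conj (w 2)) * h0
  · linear_combination (-((-(-conj (z 1) - N 0 2)) * u 0 + (-(-z 0 - N 1 2)) * u 1 + (-z 2 - N 2
      3) * u 3)) * hSdef - ((-(-conj (z 1) - N 0 2)) * conj (w 0) + (-(-z 0 - N 1 2)) * conj (w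
      1) + (-z 2 - N 2 3) * conj (w 3)) * hu
      + (u 0 * conj (w 1) - u 1 * conj (w 0)) * h3
      - (u 0 * conj (w 3) - u 3 * conj (w 0)) * h1
      + (u 1 * conj (w 3) - u 3 * conj (w 1)) * h0
  · linear_combination (-((-(-conj (z 0) - N 0 3)) * u 0 + (-(z 1 - N 1 3)) * u 1 + (-(-z 2 - N
      2 3)) * u 2)) * hSdef - ((-(-conj (z 0) - N 0 3)) * conj (w 0) + (-(z 1 - N 1 3)) * conj
      (w 1) + (-(-z 2 - N 2 3)) * conj (w 2)) * hu
      - (u 0 * conj (w 1) - u 1 * conj (w 0)) * h2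
      + (u 0 * conj (w 2) - u 2 * conj (w 0)) * h1
      - (u 1 * conj (w 2) - u 2 * conj (w 1)) * h0

/-- A linear map whose graph over `U` is isotropic agrees on `U` with a skew-symmetric matrix. -/
lemma exists_skew_eqOn {n : Type*} [Fintype n] [DecidableEq n] (U : Submodule ℂ (n → ℂ))
    (W : Matrix n n ℂ) (hW : ∀ u ∈ U, u ⬝ᵥ W *ᵥ u = 0) :
    ∃ N : Matrix n n ℂ, Nᵀ = -N ∧ ∀ u ∈ U, N *ᵥ u = W *ᵥ u := by
  obtain ⟨p, hp⟩ := U.exists_isCompl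
  obtain ⟨P, hPU, hPid⟩ : ∃ P : Matrix n n ℂ, (∀ x, P *ᵥ x ∈ U) ∧ ∀ u ∈ U, P *ᵥ u = u := by
    refine ⟨LinearMap.toMatrix' (U.subtype ∘ₗ U.projectionOnto p hp), fun x => ?_,
      fun u hu => ?_⟩
    · simp [LinearMap.toMatrix'_mulVec]
    · simpa [LinearMap.toMatrix'_mulVec] using
        congrArg Subtype.val (Submodule.projectionOnto_apply_left hp ⟨u, hu⟩)
  have key : Pᵀ * Wᵀ * P = -(Pᵀ * W * P) := by
    have polar (x y : n → ℂ) : (P *ᵥ x) ⬝ᵥ W *ᵥ (P *ᵥ y) + (P *ᵥ y) ⬝ᵥ W *ᵥ (P *ᵥ x) = 0 := by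
      have h1 := hW _ (add_mem (hPU x) (hPU y))
      simp only [mulVec_add, add_dotProduct, dotProduct_add, hW _ (hPU x), hW _ (hPU y)] at h1
      linear_combination h1
    have hT : Pᵀ * Wᵀ * P = (Pᵀ * (W * P))ᵀ := by
      simp only [transpose_mul, transpose_transpose]
    rw [hT, Matrix.mul_assoc]
    ext i j
    have h := polar (Pi.single i 1) (Pi.single j 1)
    simp only [mulVec_single_one] at h
    exact eq_neg_of_add_eq_zero_right h
  refine ⟨W * P - Pᵀ * Wᵀ + Pᵀ * Wᵀ * P, ?_, fun u hu => ?_⟩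
  · simp only [transpose_add, transpose_sub, transpose_mul, transpose_transpose, ← Matrix.mul_assoc]
    rw [key, Matrix.mul_assoc]
    abel
  · simp only [add_mulVec, sub_mulVec, ← mulVec_mulVec, hPid u hu]
    abel

lemma disjoint_of_mem_twistorFibers {F F' : Submodule ℂ ((Fin 4 → ℂ) × (Fin 4 → ℂ))}
    (hF : F ∈ twistorFibers) (hF' : F' ∈ twistorFibers) (h : F ≠ F') : Disjoint F F' := by
  have hinf (z) : Disjoint fiberInf (fiberSub z) := by
    rw [Submodule.disjoint_def]
    rintro _ hx ⟨u, rfl⟩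
    obtain rfl : u = 0 := by simpa [fiberInf] using hx
    exact map_zero _
  obtain rfl | ⟨z, rfl⟩ := hF <;> obtain rfl | ⟨z', rfl⟩ := hF'
  · exact absurd rfl h
  · exact hinf z'
  · exact (hinf z).symm
  · rw [Submodule.disjoint_def]
    rintro _ ⟨u, rfl⟩ ⟨u', hu'⟩
    obtain ⟨rfl, h2⟩ : u' = u ∧ Mz z' *ᵥ u' = Mz z *ᵥ u := by simpa using hu'
    by_contra hne
    have hu : u' ≠ 0 := by
      rintro rfl
      exact hne (map_zero _)
    exact h (by rw [eq_of_Mz_mulVec_eq hu h2])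

/-- Every isotropic 3-dimensional subspace meets some fiber in dimension at least 2. -/
lemma exists_two_le_finrank_inf (V : Submodule ℂ ((Fin 4 → ℂ) × (Fin 4 → ℂ)))
    (hdim : finrank ℂ V = 3) (hiso : ∀ p ∈ V, p.1 ⬝ᵥ p.2 = 0) :
    ∃ F ∈ twistorFibers, 2 ≤ finrank ℂ ↥(V ⊓ F) := by
  by_cases hK : 2 ≤ finrank ℂ ↥(V ⊓ fiberInf)
  · exact ⟨_, Or.inl rfl, hK⟩
  have polar {p q} (hp : p ∈ V) (hq : q ∈ V) : p.1 ⬝ᵥ q.2 + q.1 ⬝ᵥ p.2 = 0 := by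
    have h := hiso _ (add_mem hp hq)
    simp only [Prod.fst_add, Prod.snd_add, add_dotProduct, dotProduct_add, hiso p hp,
      hiso q hq] at h
    linear_combination h
  set π : V →ₗ[ℂ] (Fin 4 → ℂ) := LinearMap.fst ℂ _ _ ∘ₗ V.subtype
  obtain ⟨w, hw, hwU, hwK⟩ : ∃ w : Fin 4 → ℂ, w ≠ 0 ∧ (∀ p ∈ V, p.1 ⬝ᵥ w = 0) ∧
      ∀ y, (0, y) ∈ V → y ∈ Submodule.span ℂ {w} := by
    by_cases h0 : ∃ w : Fin 4 → ℂ, w ≠ 0 ∧ (0, w) ∈ V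
    · obtain ⟨w, hw, hwV⟩ := h0
      refine ⟨w, hw, fun p hp => by simpa using polar hp hwV, fun y hy => ?_⟩
      have h1 : finrank ℂ ↥(V ⊓ fiberInf) ≤ 1 := by omega
      obtain ⟨v, hv⟩ := finrank_le_one_iff.1 h1
      obtain ⟨a, ha⟩ := hv ⟨(0, w), hwV, by simp [fiberInf]⟩
      obtain ⟨b, hb⟩ := hv ⟨(0, y), hy, by simp [fiberInf]⟩
      have ha' : a • (v : (Fin 4 → ℂ) × (Fin 4 → ℂ)).2 = w := by
        simpa using congrArg (fun x => (x : (Fin 4 → ℂ) × (Fin 4 → ℂ)).2) (congrArg Subtype.val ha)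
      have hb' : b • (v : (Fin 4 → ℂ) × (Fin 4 → ℂ)).2 = y := by
        simpa using congrArg (fun x => (x : (Fin 4 → ℂ) × (Fin 4 → ℂ)).2) (congrArg Subtype.val hb)
      have ha0 : a ≠ 0 := by
        rintro rfl
        exact hw (by simpa using ha'.symm)
      refine Submodule.mem_span_singleton.2 ⟨b / a, ?_⟩
      rw [← ha', ← hb', smul_smul, div_mul_cancel₀ _ ha0]
    · push Not at h0
      have hlt : LinearMap.range π < ⊤ := by
        refine lt_top_iff_ne_top.2 fun htop => ?_
        have h1 := LinearMap.finrank_range_le π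
        rw [htop, finrank_top, hdim, finrank_fin_fun] at h1
        omega
      obtain ⟨f, hf, hfU⟩ := Submodule.exists_le_ker_of_lt_top _ hlt
      refine ⟨(dotProductEquiv ℂ (Fin 4)).symm f, by simpa using hf, fun p hp => ?_,
        fun y hy => ?_⟩
      · rw [dotProduct_comm]
        exact (LinearMap.congr_fun ((dotProductEquiv ℂ (Fin 4)).apply_symm_apply f) p.1).trans
          (hfU ⟨⟨p, hp⟩, rfl⟩)
      · by_contra hy'
        exact h0 y (fun hy0 => hy' (hy0 ▸ zero_mem _)) hy
  obtain ⟨σ, hσ⟩ := π.rangeRestrict.exists_rightInverse_of_surjective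
    (LinearMap.range_rangeRestrict π)
  obtain ⟨g, hg⟩ := LinearMap.exists_extend (LinearMap.snd ℂ _ _ ∘ₗ V.subtype ∘ₗ σ)
  have hgV (u) (hu : u ∈ LinearMap.range π) : (u, g u) ∈ V := by
    have h1 : (σ ⟨u, hu⟩ : (Fin 4 → ℂ) × (Fin 4 → ℂ)).1 = u :=
      congrArg Subtype.val (LinearMap.congr_fun hσ ⟨u, hu⟩)
    have h2 : g u = (σ ⟨u, hu⟩ : (Fin 4 → ℂ) × (Fin 4 → ℂ)).2 :=
      LinearMap.congr_fun hg ⟨u, hu⟩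
    rw [h2]
    nth_rw 1 [← h1]
    exact (σ ⟨u, hu⟩).2
  obtain ⟨N, hN, hNg⟩ := exists_skew_eqOn (LinearMap.range π) (LinearMap.toMatrix' g)
    fun u hu => by
      rw [LinearMap.toMatrix'_mulVec]
      exact hiso _ (hgV u hu)
  obtain ⟨z, hz⟩ := exists_Mz_mulVec_sub_mem_span hN hw
  refine ⟨fiberSub z, Or.inr ⟨z, rfl⟩, ?_⟩
  set T : V →ₗ[ℂ] (Fin 4 → ℂ) :=
    (LinearMap.snd ℂ _ _ - (Mz z).mulVecLin ∘ₗ LinearMap.fst ℂ _ _) ∘ₗ V.subtype with hT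
  have hrange : finrank ℂ (LinearMap.range T) ≤ 1 := by
    refine (Submodule.finrank_mono ?_).trans (finrank_span_singleton (K := ℂ) hw).le
    rintro _ ⟨⟨p, hp⟩, rfl⟩
    have hpU : p.1 ∈ LinearMap.range π := ⟨⟨p, hp⟩, rfl⟩
    have h1 : p.2 - g p.1 ∈ Submodule.span ℂ {w} :=
      hwK _ (by
        have := sub_mem hp (hgV _ hpU)
        rwa [← Prod.mk.eta (p := p), Prod.mk_sub_mk, sub_self] at this)
    have h2 := hNg _ hpU
    rw [LinearMap.toMatrix'_mulVec] at h2
    have h3 := hz p.1 (hwU p hp)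
    rw [h2] at h3
    simpa [hT] using sub_mem h1 h3
  have hker : (LinearMap.ker T).map V.subtype ≤ V ⊓ fiberSub z := by
    rintro _ ⟨p, hp, rfl⟩
    have h1 : (p : (Fin 4 → ℂ) × (Fin 4 → ℂ)).2 = Mz z *ᵥ (p : (Fin 4 → ℂ) × (Fin 4 → ℂ)).1 := by
      simpa [hT, sub_eq_zero] using hp
    exact ⟨p.2, _, Prod.ext rfl h1.symm⟩
  have h1 := LinearMap.finrank_range_add_finrank_ker T
  have h2 := Submodule.finrank_mono hker
  rw [Submodule.finrank_map_subtype_eq] at h2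
  omega

/-- **Linear `ℙ²`-s in the twistor quadric.** If `V` is a 3-dimensional subspace of
`ℂ⁸ = ℂ⁴ × ℂ⁴` on which the quadratic form `q(ξ,W) = Σ ξᵢWᵢ` vanishes, then either `V`
is contained in a twistor fiber, or exactly one twistor fiber meets `V` in a
2-dimensional subspace and all others meet it in dimension at most 1. -/
theorem P2_in_quadric_meets_fibers (V : Submodule ℂ ((Fin 4 → ℂ) × (Fin 4 → ℂ)))
    (hdim : finrank ℂ V = 3)
    (hiso : ∀ p ∈ V, (∑ i, p.1 i * p.2 i) = (0 : ℂ)) :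
    (∃ F ∈ twistorFibers, V ≤ F) ∨
    (∃ F ∈ twistorFibers, finrank ℂ ↥(V ⊓ F) = 2 ∧
      ∀ F' ∈ twistorFibers, F' ≠ F → finrank ℂ ↥(V ⊓ F') ≤ 1) := by
  obtain ⟨F, hF, h2⟩ := exists_two_le_finrank_inf V hdim hiso
  by_cases hVF : V ≤ F
  · exact Or.inl ⟨F, hF, hVF⟩
  have hlt := Submodule.finrank_lt_finrank_of_lt (inf_lt_left.2 hVF)
  refine Or.inr ⟨F, hF, by omega, fun F' hF' hne => ?_⟩
  have hdisj := (disjoint_of_mem_twistorFibers hF hF' hne.symm).mono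
    (inf_le_right : V ⊓ F ≤ F) (inf_le_right : V ⊓ F' ≤ F')
  have h3 := Submodule.finrank_sup_add_finrank_inf_eq (V ⊓ F) (V ⊓ F')
  have h4 := Submodule.finrank_mono (sup_le inf_le_left inf_le_left : V ⊓ F ⊔ V ⊓ F' ≤ V)
  rw [hdisj.eq_bot, finrank_bot] at h3
  omega
end

section
/- Let ℂ⁶ have basis e₁,e₂,e₃,f₁,f₂,f₃ and symmetric ℂ-bilinear form B with B(e_i,e_j) = 0 = B(f_i,f_j) and B(e_i,f_j) = δ_{ij}. For ξ = (ξ₀,ξ₁₂,ξ₁₃,ξ₂₃) ∈ ℂ⁴ ∖ {0} define η₁ = ξ₀e₁ − ξ₁₂f₂ − ξ₁₃f₃, η₂ = ξ₀e₂ + ξ₁₂f₁ − ξ₂₃f₃, η₃ = ξ₀e₃ + ξ₁₃f₁ + ξ₂₃f₂, η₁₂₃ = ξ₂₃e₁ − ξ₁₃e₂ + ξ₁₂e₃, and let V_ξ = span_ℂ{η₁,η₂,η₃,η₁₂₃}. Then: (a) for every ξ ≠ 0, V_ξ is a 3-dimensional subspace on which B vanishes identically (a maximal B-isotropic subspace);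 (b) V_ξ = V_{ξ'} if and only if ξ and ξ' are proportional, so [ξ] ↦ V_ξ is injective on ℙ³(ℂ); (c) the image of this map is exactly the set of 3-dimensional B-isotropic subspaces V ⊆ ℂ⁶ with dim_ℂ(V ∩ span(e₁,e₂,e₃)) odd. -/
open Module

/-- The complex bilinear form `B` on `ℂ⁶` with `B(e_i,e_j) = B(f_i,f_j) = 0` and
`B(e_i,f_j) = δ_{ij}`, where `e_i` are the coordinates `0,1,2` and `f_i` the
coordinates `3,4,5`. -/
def Bform (v w : Fin 6 → ℂ) : ℂ :=
  v 0 * w 3 + v 3 * w 0 + v 1 * w 4 + v 4 * w 1 + v 2 * w 5 + v 5 * w 2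

/-- `η₁ = ξ₀e₁ − ξ₁₂f₂ − ξ₁₃f₃` (with `ξ = (ξ₀,ξ₁₂,ξ₁₃,ξ₂₃)`). -/
def eta1 (ξ : Fin 4 → ℂ) : Fin 6 → ℂ := ![ξ 0, 0, 0, 0, -ξ 1, -ξ 2]

/-- `η₂ = ξ₀e₂ + ξ₁₂f₁ − ξ₂₃f₃`. -/
def eta2 (ξ : Fin 4 → ℂ) : Fin 6 → ℂ := ![0, ξ 0, 0, ξ 1, 0, -ξ 3]

/-- `η₃ = ξ₀e₃ + ξ₁₃f₁ + ξ₂₃f₂`. -/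
def eta3 (ξ : Fin 4 → ℂ) : Fin 6 → ℂ := ![0, 0, ξ 0, ξ 2, ξ 3, 0]

/-- `η₁₂₃ = ξ₂₃e₁ − ξ₁₃e₂ + ξ₁₂e₃`. -/
def eta123 (ξ : Fin 4 → ℂ) : Fin 6 → ℂ := ![ξ 3, -ξ 2, ξ 1, 0, 0, 0]

/-- The subspace `V_ξ = span{η₁,η₂,η₃,η₁₂₃}` associated to the spinor `ξ`. -/
noncomputable def Vspin (ξ : Fin 4 → ℂ) : Submodule ℂ (Fin 6 → ℂ) :=
  Submodule.span ℂ {eta1 ξ, eta2 ξ, eta3 ξ, eta123 ξ}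

/-- The fixed maximal isotropic subspace `span(e₁,e₂,e₃)`. -/
noncomputable def Espan : Submodule ℂ (Fin 6 → ℂ) :=
  Submodule.span ℂ {Pi.single 0 1, Pi.single 1 1, Pi.single 2 1}

/-- `Bform` bundled as a bilinear form. -/
noncomputable def BformBilin : LinearMap.BilinForm ℂ (Fin 6 → ℂ) :=
  LinearMap.mk₂ ℂ Bform
    (fun _ _ _ => by simp only [Bform, Pi.add_apply]; ring)
    (fun _ _ _ => by simp only [Bform, Pi.smul_apply, smul_eq_mul]; ring)
    (fun _ _ _ => by simp only [Bform, Pi.add_apply]; ring)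
    (fun _ _ _ => by simp only [Bform, Pi.smul_apply, smul_eq_mul]; ring)

lemma BformBilin_apply (v w : Fin 6 → ℂ) : BformBilin v w = Bform v w := rfl

lemma Bform_comm (v w : Fin 6 → ℂ) : Bform v w = Bform w v := by
  simp only [Bform]; ring

lemma BformBilin_nondegenerate : BformBilin.Nondegenerate := by
  have key : ∀ v : Fin 6 → ℂ, (∀ w, Bform v w = 0) → v = 0 := by
    intro v hv
    funext i
    fin_cases i
    · simpa [Bform] using hv (Pi.single 3 1)
    · simpa [Bform] using hv (Pi.single 4 1)
    · simpa [Bform] using hv (Pi.single 5 1)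
    · simpa [Bform] using hv (Pi.single 0 1)
    · simpa [Bform] using hv (Pi.single 1 1)
    · simpa [Bform] using hv (Pi.single 2 1)
  exact ⟨key, fun w hw => key w fun v => (Bform_comm w v).trans (hw v)⟩

/-- A subspace equal to its own `B`-orthogonal complement is 3-dimensional. -/
lemma finrank_eq_three_of_self_orthogonal {V : Submodule ℂ (Fin 6 → ℂ)}
    (hV : BformBilin.orthogonal V = V) : finrank ℂ ↥V = 3 := by
  have h := LinearMap.BilinForm.finrank_orthogonal BformBilin_nondegenerate V
  rw [hV, finrank_fin_fun] at h
  lia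

lemma mem_Vspin_iff_exists {ξ : Fin 4 → ℂ} {v : Fin 6 → ℂ} :
    v ∈ Vspin ξ ↔ ∃ a b c d : ℂ,
      v = a • eta1 ξ + b • eta2 ξ + c • eta3 ξ + d • eta123 ξ := by
  simp only [Vspin, Submodule.mem_span_insert, Submodule.mem_span_singleton]
  constructor
  · rintro ⟨a, _, ⟨b, _, ⟨c, _, ⟨d, rfl⟩, rfl⟩, rfl⟩, rfl⟩
    exact ⟨a, b, c, d, by abel⟩
  · rintro ⟨a, b, c, d, rfl⟩
    exact ⟨a, _, ⟨b, _, ⟨c, _, ⟨d, rfl⟩, rfl⟩, rfl⟩, by abel⟩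

lemma Bform_eq_zero_of_mem_Vspin {ξ : Fin 4 → ℂ} {v w : Fin 6 → ℂ}
    (hv : v ∈ Vspin ξ) (hw : w ∈ Vspin ξ) : Bform v w = 0 := by
  obtain ⟨a, b, c, d, rfl⟩ := mem_Vspin_iff_exists.1 hv
  obtain ⟨a', b', c', d', rfl⟩ := mem_Vspin_iff_exists.1 hw
  simp [Bform, eta1, eta2, eta3, eta123]
  ring

lemma eta1_mem (ξ : Fin 4 → ℂ) : eta1 ξ ∈ Vspin ξ := Submodule.subset_span (by simp)

lemma eta2_mem (ξ : Fin 4 → ℂ) : eta2 ξ ∈ Vspin ξ := Submodule.subset_span (by simp)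

lemma eta3_mem (ξ : Fin 4 → ℂ) : eta3 ξ ∈ Vspin ξ := Submodule.subset_span (by simp)

lemma eta123_mem (ξ : Fin 4 → ℂ) : eta123 ξ ∈ Vspin ξ := Submodule.subset_span (by simp)

/-- `V_ξ` is cut out by the equations of `B`-orthogonality to its generators. -/
lemma mem_Vspin_iff {ξ : Fin 4 → ℂ} (hξ : ξ ≠ 0) {v : Fin 6 → ℂ} :
    v ∈ Vspin ξ ↔
      ξ 0 * v 3 - ξ 1 * v 1 - ξ 2 * v 2 = 0 ∧
      ξ 0 * v 4 + ξ 1 * v 0 - ξ 3 * v 2 = 0 ∧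
      ξ 0 * v 5 + ξ 2 * v 0 + ξ 3 * v 1 = 0 ∧
      ξ 3 * v 3 - ξ 2 * v 4 + ξ 1 * v 5 = 0 := by
  constructor
  · intro hv
    obtain ⟨a, b, c, d, rfl⟩ := mem_Vspin_iff_exists.1 hv
    simp only [eta1, eta2, eta3, eta123, Pi.add_apply, Pi.smul_apply, smul_eq_mul,
      Matrix.cons_val]
    refine ⟨?_, ?_, ?_, ?_⟩ <;> ring
  · rintro ⟨h1, h2, h3, h4⟩
    rw [mem_Vspin_iff_exists]
    by_cases k0 : ξ 0 = 0
    · rw [k0] at h1 h2 h3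
      by_cases k1 : ξ 1 = 0
      · by_cases k2 : ξ 2 = 0
        · have k3 : ξ 3 ≠ 0 := fun k3 => hξ (by funext i; fin_cases i <;> assumption)
          refine ⟨0, -v 5 / ξ 3, v 4 / ξ 3, v 0 / ξ 3, ?_⟩
          funext i
          fin_cases i <;> simp [eta1, eta2, eta3, eta123] <;> field_simp <;> grind
        · refine ⟨-v 5 / ξ 2, 0, v 3 / ξ 2, -v 1 / ξ 2, ?_⟩
          funext i
          fin_cases i <;> simp [eta1, eta2, eta3, eta123] <;> field_simp <;> grind
      · refine ⟨-v 4 / ξ 1, v 3 / ξ 1, 0, v 2 / ξ 1, ?_⟩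
        funext i
        fin_cases i <;> simp [eta1, eta2, eta3, eta123] <;> field_simp <;> grind
    · refine ⟨v 0 / ξ 0, v 1 / ξ 0, v 2 / ξ 0, 0, ?_⟩
      funext i
      fin_cases i <;> simp [eta1, eta2, eta3, eta123] <;> field_simp <;> grind

lemma orthogonal_Vspin {ξ : Fin 4 → ℂ} (hξ : ξ ≠ 0) :
    BformBilin.orthogonal (Vspin ξ) = Vspin ξ := by
  ext v
  rw [LinearMap.BilinForm.mem_orthogonal_iff]
  refine ⟨fun h => (mem_Vspin_iff hξ).2 ⟨?_, ?_, ?_, ?_⟩,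
    fun hv w hw => Bform_eq_zero_of_mem_Vspin hw hv⟩
  · rw [← h _ (eta1_mem ξ)]; simp [BformBilin_apply, Bform, eta1]; ring
  · rw [← h _ (eta2_mem ξ)]; simp [BformBilin_apply, Bform, eta2]; ring
  · rw [← h _ (eta3_mem ξ)]; simp [BformBilin_apply, Bform, eta3]; ring
  · rw [← h _ (eta123_mem ξ)]; simp [BformBilin_apply, Bform, eta123]; ring

lemma finrank_Vspin {ξ : Fin 4 → ℂ} (hξ : ξ ≠ 0) : finrank ℂ ↥(Vspin ξ) = 3 :=
  finrank_eq_three_of_self_orthogonal (orthogonal_Vspin hξ)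

/-- Vectors all of whose `2 × 2` minors vanish are proportional. -/
lemma exists_smul_eq_of_minors {ι K : Type*} [Field K] {x y : ι → K} (hx : x ≠ 0) (hy : y ≠ 0)
    (h : ∀ i j, x i * y j = x j * y i) : ∃ c : K, c ≠ 0 ∧ y = c • x := by
  obtain ⟨i, hi⟩ := Function.ne_iff.1 hx
  have hxi : x i ≠ 0 := hi
  have hyx : y = (y i / x i) • x := by
    funext j
    simp only [Pi.smul_apply, smul_eq_mul]
    field_simp
    linear_combination h i j
  refine ⟨y i / x i, fun hc => hy ?_, hyx⟩
  rw [hyx, hc, zero_smul]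

lemma Vspin_eq_iff {ξ ξ' : Fin 4 → ℂ} (hξ : ξ ≠ 0) (hξ' : ξ' ≠ 0) :
    Vspin ξ = Vspin ξ' ↔ ∃ c : ℂ, c ≠ 0 ∧ ξ' = c • ξ := by
  constructor
  · intro h
    have h1 := (mem_Vspin_iff hξ').1 (h ▸ eta1_mem ξ)
    have h2 := (mem_Vspin_iff hξ').1 (h ▸ eta2_mem ξ)
    have h3 := (mem_Vspin_iff hξ').1 (h ▸ eta3_mem ξ)
    simp only [eta1, eta2, eta3, Matrix.cons_val] at h1 h2 h3
    refine exists_smul_eq_of_minors hξ hξ' fun i j => ?_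
    fin_cases i <;> fin_cases j <;> grind
  · rintro ⟨c, hc, rfl⟩
    ext v
    rw [mem_Vspin_iff hξ, mem_Vspin_iff hξ']
    simp only [Pi.smul_apply, smul_eq_mul, mul_assoc, ← mul_sub, ← mul_add, mul_eq_zero, hc,
      false_or]

/-- The projection to the coordinates along `f₁, f₂, f₃`. -/
noncomputable def fPart : (Fin 6 → ℂ) →ₗ[ℂ] (Fin 3 → ℂ) := LinearMap.funLeft ℂ ℂ ![3, 4, 5]

lemma fPart_apply (v : Fin 6 → ℂ) : fPart v = ![v 3, v 4, v 5] := by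
  funext i
  fin_cases i <;> rfl

lemma mem_Espan_iff {v : Fin 6 → ℂ} : v ∈ Espan ↔ v 3 = 0 ∧ v 4 = 0 ∧ v 5 = 0 := by
  simp only [Espan, Submodule.mem_span_insert, Submodule.mem_span_singleton]
  constructor
  · rintro ⟨a, _, ⟨b, _, ⟨c, rfl⟩, rfl⟩, rfl⟩
    simp
  · rintro ⟨h3, h4, h5⟩
    refine ⟨v 0, _, ⟨v 1, _, ⟨v 2, rfl⟩, rfl⟩, ?_⟩
    funext i
    fin_cases i <;> simp [h3, h4, h5]

lemma Espan_eq_ker : Espan = LinearMap.ker fPart := by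
  ext v
  rw [mem_Espan_iff, LinearMap.mem_ker, fPart_apply]
  simp [funext_iff, Fin.forall_fin_succ]

lemma Espan_eq_Vspin {ξ : Fin 4 → ℂ} (h0 : ξ 0 ≠ 0) (h1 : ξ 1 = 0) (h2 : ξ 2 = 0)
    (h3 : ξ 3 = 0) : Espan = Vspin ξ := by
  ext v
  rw [mem_Espan_iff, mem_Vspin_iff (Function.ne_iff.2 ⟨0, h0⟩)]
  simp [h0, h1, h2, h3]

lemma finrank_Espan : finrank ℂ ↥Espan = 3 := by
  rw [Espan_eq_Vspin (ξ := ![1, 0, 0, 0]) (by simp) rfl rfl rfl]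
  exact finrank_Vspin (Function.ne_iff.2 ⟨0, by simp⟩)

lemma Vspin_inf_Espan {ξ : Fin 4 → ℂ} (h : ξ 1 ≠ 0 ∨ ξ 2 ≠ 0 ∨ ξ 3 ≠ 0) :
    Vspin ξ ⊓ Espan = Submodule.span ℂ {eta123 ξ} := by
  have hξ : ξ ≠ 0 := by rintro rfl; simp at h
  ext v
  rw [Submodule.mem_inf, mem_Espan_iff, mem_Vspin_iff hξ, Submodule.mem_span_singleton]
  constructor
  · rintro ⟨⟨e1, e2, e3, -⟩, h3, h4, h5⟩
    rw [h3] at e1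
    rw [h4] at e2
    rw [h5] at e3
    rcases h with h | h | h
    · refine ⟨v 2 / ξ 1, ?_⟩
      funext i
      fin_cases i <;> simp [eta123] <;> grind
    · refine ⟨-v 1 / ξ 2, ?_⟩
      funext i
      fin_cases i <;> simp [eta123] <;> grind
    · refine ⟨v 0 / ξ 3, ?_⟩
      funext i
      fin_cases i <;> simp [eta123] <;> grind
  · rintro ⟨a, rfl⟩
    simp only [eta123, Pi.smul_apply, smul_eq_mul, Matrix.cons_val]
    refine ⟨⟨?_, ?_, ?_, ?_⟩, ?_, ?_, ?_⟩ <;> ring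

lemma odd_finrank_Vspin_inf_Espan {ξ : Fin 4 → ℂ} (hξ : ξ ≠ 0) :
    Odd (finrank ℂ ↥(Vspin ξ ⊓ Espan)) := by
  by_cases h : ξ 1 ≠ 0 ∨ ξ 2 ≠ 0 ∨ ξ 3 ≠ 0
  · rw [Vspin_inf_Espan h, finrank_span_singleton]
    · exact odd_one
    · intro h0
      have e0 := congrFun h0 0
      have e1 := congrFun h0 1
      have e2 := congrFun h0 2
      simp [eta123] at e0 e1 e2
      simp [e0, e1, e2] at h
  · push Not at h
    obtain ⟨h1, h2, h3⟩ := h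
    have h0 : ξ 0 ≠ 0 := fun h0 => hξ (by funext i; fin_cases i <;> assumption)
    rw [← Espan_eq_Vspin h0 h1 h2 h3, inf_idem, finrank_Espan]
    decide

lemma finrank_map_fPart_add (V : Submodule ℂ (Fin 6 → ℂ)) :
    finrank ℂ ↥(V.map fPart) + finrank ℂ ↥(V ⊓ Espan) = finrank ℂ ↥V := by
  have h := (fPart.domRestrict V).finrank_range_add_finrank_ker
  rwa [LinearMap.range_domRestrict, LinearMap.ker_domRestrict, ← Espan_eq_ker,
    ← Submodule.finrank_map_subtype_eq, Submodule.map_comap_subtype] at h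

/-- An isotropic 3-dimensional subspace meeting `span(e₁,e₂,e₃)` in a line is some `V_ξ`. -/
lemma exists_eq_Vspin_of_finrank_inf_eq_one {V : Submodule ℂ (Fin 6 → ℂ)}
    (hV : finrank ℂ ↥V = 3) (hB : ∀ v ∈ V, ∀ w ∈ V, Bform v w = 0)
    (h1 : finrank ℂ ↥(V ⊓ Espan) = 1) : ∃ ξ : Fin 4 → ℂ, ξ ≠ 0 ∧ V = Vspin ξ := by
  have h2 : finrank ℂ ↥(V.map fPart) = 2 := by
    have := finrank_map_fPart_add V
    lia
  let b := finBasisOfFinrankEq ℂ _ h2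
  obtain ⟨p, hp, hpb⟩ := Submodule.mem_map.1 (b 0).2
  obtain ⟨q, hq, hqb⟩ := Submodule.mem_map.1 (b 1).2
  have hlin : LinearIndependent ℂ ![fPart p, fPart q] := by
    have := b.linearIndependent.map' (V.map fPart).subtype (Submodule.ker_subtype _)
    have hpq : ![fPart p, fPart q] = (V.map fPart).subtype ∘ b := by
      funext i
      fin_cases i
      · exact hpb
      · exact hqb
    rwa [hpq]
  have hcross := crossProduct_ne_zero_iff_linearIndependent.2 hlin
  have hspan : ∀ v ∈ V, ∃ x y : ℂ, fPart v = x • fPart p + y • fPart q := by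
    intro v hv
    have := congrArg Subtype.val (b.sum_repr ⟨fPart v, Submodule.mem_map_of_mem hv⟩)
    rw [Fin.sum_univ_two] at this
    exact ⟨_, _, by rw [hpb, hqb]; exact this.symm⟩
  -- `ξ₀ = a · b'` and `(ξ₂₃, -ξ₁₃, ξ₁₂) = b × b'`, where `p = (a, b)` and `q = (a', b')`
  let ξ : Fin 4 → ℂ := ![p 0 * q 3 + p 1 * q 4 + p 2 * q 5, p 3 * q 4 - p 4 * q 3,
    p 3 * q 5 - p 5 * q 3, p 4 * q 5 - p 5 * q 4]
  have hξ : ξ ≠ 0 := by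
    intro h
    apply hcross
    have e1 := congrFun h 1
    have e2 := congrFun h 2
    have e3 := congrFun h 3
    simp only [ξ, Matrix.cons_val, Pi.zero_apply] at e1 e2 e3
    rw [fPart_apply, fPart_apply, cross_apply]
    funext i
    fin_cases i <;> simp <;> grind
  refine ⟨ξ, hξ, Submodule.eq_of_le_of_finrank_eq (fun v hv => ?_) ?_⟩
  · obtain ⟨x, y, hxy⟩ := hspan v hv
    simp only [fPart_apply] at hxy
    have e3 := congrFun hxy 0
    have e4 := congrFun hxy 1
    have e5 := congrFun hxy 2
    have epp := hB p hp p hp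
    have epq := hB p hp q hq
    have eqq := hB q hq q hq
    have epv := hB p hp v hv
    have eqv := hB q hq v hv
    simp at e3 e4 e5
    simp only [Bform, e3, e4, e5] at epp epq eqq epv eqv
    rw [mem_Vspin_iff hξ]
    simp only [ξ, Matrix.cons_val, e3, e4, e5]
    refine ⟨?_, ?_, ?_, ?_⟩
    · linear_combination q 3 * (epv - x / 2 * epp) - p 3 * (eqv - x * epq - y / 2 * eqq)
    · linear_combination q 4 * (epv - x / 2 * epp) - p 4 * (eqv - x * epq - y / 2 * eqq)
    · linear_combination q 5 * (epv - x / 2 * epp) - p 5 * (eqv - x * epq - y / 2 * eqq)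
    · ring
  · rw [hV, finrank_Vspin hξ]

/-- **Spinor parametrization of one family of maximal isotropic subspaces of `ℂ⁶`.**
(a) `V_ξ` is 3-dimensional and `B`-isotropic for every `ξ ≠ 0`;
(b) `[ξ] ↦ V_ξ` is injective on `ℙ³(ℂ)`;
(c) the image is exactly the 3-dimensional isotropic subspaces `V` with
`dim(V ∩ span(e₁,e₂,e₃))` odd. -/
theorem spinor_parametrization :
    (∀ ξ : Fin 4 → ℂ, ξ ≠ 0 →
      finrank ℂ ↥(Vspin ξ) = 3 ∧ ∀ v ∈ Vspin ξ, ∀ w ∈ Vspin ξ, Bform v w = 0) ∧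
    (∀ ξ ξ' : Fin 4 → ℂ, ξ ≠ 0 → ξ' ≠ 0 →
      (Vspin ξ = Vspin ξ' ↔ ∃ c : ℂ, c ≠ 0 ∧ ξ' = c • ξ)) ∧
    (∀ V : Submodule ℂ (Fin 6 → ℂ),
      (finrank ℂ ↥V = 3 ∧ (∀ v ∈ V, ∀ w ∈ V, Bform v w = 0) ∧
          Odd (finrank ℂ ↥(V ⊓ Espan)))
        ↔ ∃ ξ : Fin 4 → ℂ, ξ ≠ 0 ∧ V = Vspin ξ) := by
  refine ⟨fun ξ hξ => ⟨finrank_Vspin hξ, fun v hv w hw => Bform_eq_zero_of_mem_Vspin hv hw⟩,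
    fun ξ ξ' hξ hξ' => Vspin_eq_iff hξ hξ', fun V => ⟨?_, ?_⟩⟩
  · rintro ⟨hV, hB, hodd⟩
    have hle : finrank ℂ ↥(V ⊓ Espan) ≤ 3 := hV ▸ Submodule.finrank_mono inf_le_left
    have h13 : finrank ℂ ↥(V ⊓ Espan) = 1 ∨ finrank ℂ ↥(V ⊓ Espan) = 3 := by
      obtain ⟨k, hk⟩ := hodd
      lia
    rcases h13 with h | h
    · exact exists_eq_Vspin_of_finrank_inf_eq_one hV hB h
    · refine ⟨![1, 0, 0, 0], Function.ne_iff.2 ⟨0, by simp⟩, ?_⟩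
      rw [← Espan_eq_Vspin (by simp) rfl rfl rfl,
        ← Submodule.eq_of_le_of_finrank_eq inf_le_left (h.trans hV.symm)]
      exact Submodule.eq_of_le_of_finrank_eq inf_le_right (h.trans finrank_Espan.symm)
  · rintro ⟨ξ, hξ, rfl⟩
    exact ⟨finrank_Vspin hξ, fun v hv w hw => Bform_eq_zero_of_mem_Vspin hv hw,
      odd_finrank_Vspin_inf_Espan hξ⟩
end

section
/- Let ξ : ℂ³ → ℂ⁴ ∖ {0} be continuous with ξ(z) → (1,0,0,0) as ‖z‖ → ∞, and define G : ℂ³ → ℙ(ℂ⁴×ℂ⁴) = ℙ(ℂ⁸) by G(z) = [(ξ(z), M(z)·ξ(z))]. Then the closure of the image G(ℂ³) in ℙ(ℂ⁸) equals G(ℂ³) ∪ {[(0, W)] : W ∈ ℂ⁴ ∖ {0}, W₁ = 0} (i.e. the closure adds exactly the projective plane of classes [(0,(0,a,b,c))] with (a,b,c) ∈ ℂ³ ∖ {0} inside the fiber over infinity). Moreover, this closure is homeomorphic to ℙ³(ℂ). -/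
open Matrix Filter

noncomputable instance projTop {K V : Type*} [DivisionRing K] [AddCommGroup V] [Module K V]
    [TopologicalSpace V] : TopologicalSpace (Projectivization K V) :=
  inferInstanceAs (TopologicalSpace (Quotient _))

/-- The twistor graph `G(z) = [(ξ(z), M(z)·ξ(z))]` of a spinor field `ξ`. -/
noncomputable def graphG (ξ : (Fin 3 → ℂ) → (Fin 4 → ℂ)) (hnz : ∀ z, ξ z ≠ 0)
    (z : Fin 3 → ℂ) : Projectivization ℂ ((Fin 4 → ℂ) × (Fin 4 → ℂ)) :=
  Projectivization.mk ℂ (ξ z, (Mz z).mulVec (ξ z))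
    (fun h => hnz z (congrArg Prod.fst h))

namespace Projectivization

section Topology

variable (K V : Type*) [DivisionRing K] [AddCommGroup V] [Module K V] [TopologicalSpace V]

theorem isOpenQuotientMap_mk' [ContinuousConstSMul K V] :
    IsOpenQuotientMap (Projectivization.mk' K : {v : V // v ≠ 0} → Projectivization K V) where
  surjective := Quotient.mk''_surjective
  continuous := continuous_quotient_mk'
  isOpenMap U hU := by
    have key : Projectivization.mk' K ⁻¹' (Projectivization.mk' K '' U) =
        ⋃ a : Kˣ, (fun v : {v : V // v ≠ 0} ↦
          (⟨a • v.1, (smul_ne_zero_iff_ne a).2 v.2⟩ : {v : V // v ≠ 0})) ⁻¹' U := by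
      ext v
      simp only [Set.mem_preimage, Set.mem_image, Set.mem_iUnion, mk'_eq_mk]
      constructor
      · rintro ⟨w, hw, hwv⟩
        obtain ⟨a, ha⟩ := (mk_eq_mk_iff K _ _ w.2 v.2).1 hwv
        exact ⟨a, by simpa only [ha] using hw⟩
      · rintro ⟨a, ha⟩
        exact ⟨_, ha, (mk_eq_mk_iff K _ _ _ _).2 ⟨a, rfl⟩⟩
    change IsOpen (Projectivization.mk' K ⁻¹' (Projectivization.mk' K '' U))
    rw [key]
    exact isOpen_iUnion fun a ↦ hU.preimage <|
      (continuous_subtype_val.const_smul a).subtype_mk _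

end Topology

theorem mk_eq_mk_iff_dual {K V : Type*} [Field K] [AddCommGroup V] [Module K V]
    [TopologicalSpace K] [IsTopologicalRing K] [TopologicalSpace V] [SeparatingDual K V]
    {v w : V} (hv : v ≠ 0) (hw : w ≠ 0) :
    mk K v hv = mk K w hw ↔ ∀ f g : StrongDual K V, f v * g w = f w * g v := by
  rw [mk_eq_mk_iff']
  constructor
  · rintro ⟨a, rfl⟩ f g
    simp only [map_smul, smul_eq_mul]
    ring
  · intro h
    obtain ⟨f, hf⟩ := SeparatingDual.exists_eq_one (R := K) hw
    refine ⟨f v, (SeparatingDual.eq_iff_forall_dual_eq (R := K)).2 fun g ↦ ?_⟩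
    simpa [hf] using h f g

instance {K V : Type*} [Field K] [AddCommGroup V] [Module K V] [TopologicalSpace K]
    [TopologicalSpace V] [IsTopologicalRing K] [T2Space K] [ContinuousConstSMul K V]
    [SeparatingDual K V] : T2Space (Projectivization K V) := by
  rw [t2Space_iff_of_isOpenQuotientMap (isOpenQuotientMap_mk' K V)]
  simp only [mk'_eq_mk, mk_eq_mk_iff_dual, Set.ofPred_forall]
  exact isClosed_iInter fun f ↦ isClosed_iInter fun g ↦ isClosed_eq (by fun_prop) (by fun_prop)

instance {K V : Type*} [RCLike K] [NormedAddCommGroup V] [NormedSpace K V] [ProperSpace V] :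
    CompactSpace (Projectivization K V) := by
  have hne (v : Metric.sphere (0 : V) 1) : (v : V) ≠ 0 := ne_zero_of_mem_unit_sphere v
  have hsurj : Function.Surjective
      fun v : Metric.sphere (0 : V) 1 ↦ Projectivization.mk' K ⟨(v : V), hne v⟩ := by
    intro p
    induction p using Projectivization.ind with | h v hv => ?_
    have hv' : ‖v‖ ≠ 0 := norm_ne_zero_iff.2 hv
    refine ⟨⟨((‖v‖⁻¹ : ℝ) : K) • v, ?_⟩, ?_⟩
    · simp [norm_smul, hv']
    · exact (mk_eq_mk_iff' K _ _ _ _).2 ⟨_, rfl⟩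
  exact hsurj.compactSpace <|
    (isOpenQuotientMap_mk' K V).continuous.comp (continuous_subtype_val.subtype_mk _)

end Projectivization

theorem Mz_sub (z w : Fin 3 → ℂ) : Mz (z - w) = Mz z - Mz w := by
  ext i j
  fin_cases i <;> fin_cases j <;> simp [Mz] <;> ring

theorem conjTranspose_Mz_mul_Mz (z : Fin 3 → ℂ) :
    (Mz z)ᴴ * Mz z = ((∑ i, ‖z i‖ ^ 2 : ℝ) : ℂ) • (1 : Matrix (Fin 4) (Fin 4) ℂ) := by
  ext i j
  fin_cases i <;> fin_cases j <;>
    simp [Mz, Matrix.mul_apply, Fin.sum_univ_succ, ← Complex.conj_mul'] <;> ring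

theorem eq_zero_of_Mz_mulVec_eq_zero {z : Fin 3 → ℂ} {x : Fin 4 → ℂ} (hx : x ≠ 0)
    (h : Mz z *ᵥ x = 0) : z = 0 := by
  have h' : (∑ i, ‖z i‖ ^ 2 : ℝ) = 0 := by
    have := congrArg ((Mz z)ᴴ *ᵥ ·) h
    simp only [mulVec_mulVec, conjTranspose_Mz_mul_Mz, smul_mulVec, one_mulVec,
      mulVec_zero] at this
    exact_mod_cast (smul_eq_zero.1 this).resolve_right hx
  funext i
  simpa using (Finset.sum_eq_zero_iff_of_nonneg (fun i _ ↦ sq_nonneg ‖z i‖)).1 h' i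

theorem graphG_injective (ξ : (Fin 3 → ℂ) → (Fin 4 → ℂ)) (hnz : ∀ z, ξ z ≠ 0) :
    Function.Injective (graphG ξ hnz) := by
  intro z w h
  obtain ⟨a, ha⟩ := (Projectivization.mk_eq_mk_iff' ℂ _ _ _ _).1 h
  simp only [Prod.smul_mk, Prod.mk.injEq] at ha
  refine sub_eq_zero.1 (eq_zero_of_Mz_mulVec_eq_zero (hnz z) ?_)
  rw [Mz_sub, sub_mulVec, ← ha.2, ← ha.1, mulVec_smul, sub_self]

/-- The point of `ℂ³` with homogeneous coordinates `v`; zero if `v 0 = 0`. -/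
noncomputable def affinePoint (v : Fin 4 → ℂ) : Fin 3 → ℂ := (v 0)⁻¹ • Fin.tail v

theorem affinePoint_smul {a : ℂ} (ha : a ≠ 0) (v : Fin 4 → ℂ) :
    affinePoint (a • v) = affinePoint v := by
  ext i
  simp [affinePoint, Fin.tail]
  field_simp

theorem affinePoint_cons_one (z : Fin 3 → ℂ) : affinePoint (Fin.cons 1 z) = z := by
  simp [affinePoint]

theorem smul_affinePoint {v : Fin 4 → ℂ} (hv : v 0 ≠ 0) : v 0 • affinePoint v = Fin.tail v := by
  simp [affinePoint, hv]

theorem tendsto_affinePoint {v : Fin 4 → ℂ} (hv : v ≠ 0) (hv0 : v 0 = 0) :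
    Tendsto affinePoint (nhdsWithin v {w | w 0 ≠ 0}) (cocompact (Fin 3 → ℂ)) := by
  rw [← Metric.cobounded_eq_cocompact, ← tendsto_norm_atTop_iff_cobounded]
  have ht : Fin.tail v ≠ 0 := by
    contrapose! hv
    rw [← Fin.cons_self_tail v, hv, hv0]
    ext i
    cases i using Fin.cases <;> simp
  have h0 : Tendsto (fun w : Fin 4 → ℂ ↦ w 0) (nhdsWithin v {w | w 0 ≠ 0})
      (nhdsWithin 0 {0}ᶜ) := by
    refine tendsto_nhdsWithin_iff.2 ⟨?_, eventually_mem_nhdsWithin⟩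
    rw [← hv0]
    exact (continuous_apply 0).continuousAt.tendsto.mono_left nhdsWithin_le_nhds
  have htail : Continuous fun w : Fin 4 → ℂ ↦ Fin.tail w :=
    continuous_pi fun i ↦ continuous_apply i.succ
  simp only [affinePoint, norm_smul]
  exact (tendsto_norm_inv_nhdsNE_zero_atTop.comp h0).atTop_mul_pos (norm_pos_iff.2 ht)
    (htail.norm.continuousAt.tendsto.mono_left nhdsWithin_le_nhds)

section Lift

variable (ξ : (Fin 3 → ℂ) → (Fin 4 → ℂ))

open Classical in
/-- The spinor field in homogeneous coordinates, with value `(1,0,0,0)` at infinity. -/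
noncomputable def spinorExt (v : Fin 4 → ℂ) : Fin 4 → ℂ :=
  if v 0 = 0 then ![1, 0, 0, 0] else ξ (affinePoint v)

theorem continuousAt_spinorExt (hcont : Continuous ξ)
    (hlim : Tendsto ξ (cocompact (Fin 3 → ℂ)) (nhds ![1, 0, 0, 0])) {v : Fin 4 → ℂ} (hv : v ≠ 0) :
    ContinuousAt (spinorExt ξ) v := by
  by_cases hv0 : v 0 = 0
  · have hval : spinorExt ξ v = ![1, 0, 0, 0] := if_pos hv0
    rw [ContinuousAt, hval]
    exact Tendsto.if tendsto_const_nhds (hlim.comp (tendsto_affinePoint hv hv0))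
  · have hne : ∀ᶠ w in nhds v, w 0 ≠ 0 := (continuous_apply 0).continuousAt.eventually_ne hv0
    have htail : Continuous fun w : Fin 4 → ℂ ↦ Fin.tail w :=
      continuous_pi fun i ↦ continuous_apply i.succ
    have haff : ContinuousAt affinePoint v :=
      ((continuous_apply 0).continuousAt.inv₀ hv0).smul htail.continuousAt
    refine (hcont.continuousAt.comp haff).congr ?_
    filter_upwards [hne] with w hw
    simp [spinorExt, hw]

/-- The phase `t / conj t` of the homogenizing coordinate. -/
noncomputable def phase (v : Fin 4 → ℂ) : ℂ := v 0 / (starRingEnd ℂ) (v 0)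

theorem norm_phase_le (v : Fin 4 → ℂ) : ‖phase v‖ ≤ 1 := by
  simp [phase, div_self_le_one]

theorem continuousAt_phase_mul_spinorExt (hcont : Continuous ξ)
    (hlim : Tendsto ξ (cocompact (Fin 3 → ℂ)) (nhds ![1, 0, 0, 0])) {v : Fin 4 → ℂ} (hv : v ≠ 0)
    {i : Fin 4} (hi : i ≠ 0) : ContinuousAt (fun w ↦ phase w * spinorExt ξ w i) v := by
  have hs : ContinuousAt (fun w ↦ spinorExt ξ w i) v :=
    (continuous_apply i).continuousAt.comp (continuousAt_spinorExt ξ hcont hlim hv)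
  by_cases hv0 : v 0 = 0
  · have hsv : spinorExt ξ v i = 0 := by
      rw [spinorExt, if_pos hv0]
      fin_cases i <;> simp_all
    rw [ContinuousAt, hsv] at hs
    rw [ContinuousAt, hsv, mul_zero]
    refine squeeze_zero_norm (fun w ↦ ?_) (tendsto_zero_iff_norm_tendsto_zero.1 hs)
    rw [norm_mul]
    exact mul_le_of_le_one_left (norm_nonneg _) (norm_phase_le w)
  · refine ContinuousAt.mul ?_ hs
    have h0 : ContinuousAt (fun w : Fin 4 → ℂ ↦ w 0) v := (continuous_apply 0).continuousAt
    exact h0.div (Complex.continuous_conj.continuousAt.comp h0) (by simpa using hv0)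

/-- The twistor graph in homogeneous coordinates. -/
noncomputable def graphLift (v : Fin 4 → ℂ) : (Fin 4 → ℂ) × (Fin 4 → ℂ) :=
  let e := spinorExt ξ v
  let c := phase v
  (v 0 • e,
    ![-v 3 * e 1 - v 2 * e 2 - v 1 * e 3,
      v 3 * e 0 - (starRingEnd ℂ) (v 1) * (c * e 2) + (starRingEnd ℂ) (v 2) * (c * e 3),
      v 2 * e 0 + (starRingEnd ℂ) (v 1) * (c * e 1) - (starRingEnd ℂ) (v 3) * (c * e 3),
      v 1 * e 0 - (starRingEnd ℂ) (v 2) * (c * e 1) + (starRingEnd ℂ) (v 3) * (c * e 2)])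

theorem continuousAt_graphLift (hcont : Continuous ξ)
    (hlim : Tendsto ξ (cocompact (Fin 3 → ℂ)) (nhds ![1, 0, 0, 0])) {v : Fin 4 → ℂ} (hv : v ≠ 0) :
    ContinuousAt (graphLift ξ) v := by
  have hs := continuousAt_spinorExt ξ hcont hlim hv
  have he (i : Fin 4) : ContinuousAt (fun w ↦ spinorExt ξ w i) v :=
    (continuous_apply i).continuousAt.comp hs
  have hc {i : Fin 4} (hi : i ≠ 0) := continuousAt_phase_mul_spinorExt ξ hcont hlim hv hi
  have h1 := hc (i := 1) (by decide)
  have h2 := hc (i := 2) (by decide)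
  have h3 := hc (i := 3) (by decide)
  have hx (i : Fin 4) : ContinuousAt (fun w : Fin 4 → ℂ ↦ w i) v :=
    (continuous_apply i).continuousAt
  have hb (i : Fin 4) : ContinuousAt (fun w : Fin 4 → ℂ ↦ (starRingEnd ℂ) (w i)) v :=
    Complex.continuous_conj.continuousAt.comp (hx i)
  refine ((hx 0).smul hs).prodMk (continuousAt_pi.2 fun i ↦ ?_)
  fin_cases i
  · exact (((hx 3).neg.mul (he 1)).sub ((hx 2).mul (he 2))).sub ((hx 1).mul (he 3))
  · exact (((hx 3).mul (he 0)).sub ((hb 1).mul h2)).add ((hb 2).mul h3)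
  · exact (((hx 2).mul (he 0)).add ((hb 1).mul h1)).sub ((hb 3).mul h3)
  · exact (((hx 1).mul (he 0)).sub ((hb 2).mul h1)).add ((hb 3).mul h2)

theorem graphLift_of_eq_zero {v : Fin 4 → ℂ} (hv0 : v 0 = 0) :
    graphLift ξ v = (0, ![0, v 3, v 2, v 1]) := by
  simp [graphLift, spinorExt, phase, hv0]

theorem graphLift_of_ne_zero {v : Fin 4 → ℂ} (hv0 : v 0 ≠ 0) :
    graphLift ξ v = v 0 • (ξ (affinePoint v), Mz (affinePoint v) *ᵥ ξ (affinePoint v)) := by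
  have hv0' : (starRingEnd ℂ) (v 0) ≠ 0 := by simpa using hv0
  refine Prod.ext (by simp [graphLift, spinorExt, hv0]) ?_
  ext i
  have h1 := congrFun (smul_affinePoint hv0) 0
  have h2 := congrFun (smul_affinePoint hv0) 1
  have h3 := congrFun (smul_affinePoint hv0) 2
  simp only [Fin.tail, Pi.smul_apply, smul_eq_mul, Fin.succ_zero_eq_one,
    Fin.succ_one_eq_two] at h1 h2 h3
  change _ = v 3 at h3
  fin_cases i <;>
    simp [graphLift, spinorExt, phase, hv0, Mz, dotProduct, Fin.sum_univ_succ,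
      ← h1, ← h2, ← h3] <;> field_simp <;> ring

theorem graphLift_smul {a : ℂ} (ha : a ≠ 0) (v : Fin 4 → ℂ) :
    graphLift ξ (a • v) = a • graphLift ξ v := by
  by_cases hv0 : v 0 = 0
  · simp [graphLift_of_eq_zero, hv0]
  · rw [graphLift_of_ne_zero ξ hv0, graphLift_of_ne_zero ξ (by simp [ha, hv0]),
      affinePoint_smul ha, smul_smul, Pi.smul_apply, smul_eq_mul]

variable {ξ}

theorem graphLift_fst_eq_zero_iff (hnz : ∀ z, ξ z ≠ 0) {v : Fin 4 → ℂ} :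
    (graphLift ξ v).1 = 0 ↔ v 0 = 0 := by
  by_cases hv0 : v 0 = 0
  · simp [graphLift_of_eq_zero, hv0]
  · simp [graphLift_of_ne_zero, hv0, hnz]

theorem graphLift_ne_zero (hnz : ∀ z, ξ z ≠ 0) {v : Fin 4 → ℂ} (hv : v ≠ 0) :
    graphLift ξ v ≠ 0 := by
  intro h
  have hv0 := (graphLift_fst_eq_zero_iff hnz).1 (congrArg Prod.fst h)
  rw [graphLift_of_eq_zero ξ hv0] at h
  apply hv
  ext i
  fin_cases i <;> simp_all

variable (hnz : ∀ z, ξ z ≠ 0)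

/-- The extension of the twistor graph to a map `ℙ³(ℂ) → ℙ⁷(ℂ)`. -/
noncomputable def graphExt :
    Projectivization ℂ (Fin 4 → ℂ) → Projectivization ℂ ((Fin 4 → ℂ) × (Fin 4 → ℂ)) :=
  Projectivization.lift
    (fun v ↦ Projectivization.mk ℂ (graphLift ξ v) (graphLift_ne_zero hnz v.2)) <| by
      rintro ⟨v, hv⟩ ⟨w, hw⟩ a (rfl : v = a • w)
      have ha : a ≠ 0 := fun h ↦ hv (by simp [h])
      exact (Projectivization.mk_eq_mk_iff' ℂ _ _ _ _).2 ⟨a, (graphLift_smul ξ ha w).symm⟩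

theorem graphExt_mk {v : Fin 4 → ℂ} (hv : v ≠ 0) :
    graphExt hnz (Projectivization.mk ℂ v hv) =
      Projectivization.mk ℂ (graphLift ξ v) (graphLift_ne_zero hnz hv) := rfl

theorem graphExt_mk_of_ne_zero {v : Fin 4 → ℂ} (hv : v ≠ 0) (hv0 : v 0 ≠ 0) :
    graphExt hnz (Projectivization.mk ℂ v hv) = graphG ξ hnz (affinePoint v) :=
  (Projectivization.mk_eq_mk_iff' ℂ _ _ _ _).2 ⟨v 0, (graphLift_of_ne_zero ξ hv0).symm⟩

theorem graphExt_injective : Function.Injective (graphExt hnz) := by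
  intro p q h
  induction p using Projectivization.ind with | h v hv => ?_
  induction q using Projectivization.ind with | h w hw => ?_
  obtain ⟨a, ha⟩ := (Projectivization.mk_eq_mk_iff' ℂ _ _ _ _).1 h
  have ha0 : a ≠ 0 := by
    rintro rfl
    exact graphLift_ne_zero hnz hv (by simp [← ha])
  have hiff : w 0 = 0 ↔ v 0 = 0 := by
    rw [← graphLift_fst_eq_zero_iff hnz, ← graphLift_fst_eq_zero_iff hnz (v := v), ← ha,
      Prod.smul_fst, smul_eq_zero_iff_right ha0]
  rw [Projectivization.mk_eq_mk_iff']
  by_cases hv0 : v 0 = 0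
  · refine ⟨a, ?_⟩
    have hw0 := hiff.2 hv0
    rw [graphLift_of_eq_zero ξ hv0, graphLift_of_eq_zero ξ hw0] at ha
    have h2 := congrArg Prod.snd ha
    ext i
    fin_cases i
    · simp [hv0, hw0]
    · simpa using congrFun h2 3
    · simpa using congrFun h2 2
    · simpa using congrFun h2 1
  · have hw0 : w 0 ≠ 0 := hiff.not.2 hv0
    rw [graphExt_mk_of_ne_zero hnz hv hv0, graphExt_mk_of_ne_zero hnz hw hw0] at h
    have hz := graphG_injective ξ hnz h
    refine ⟨v 0 / w 0, ?_⟩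
    ext i
    cases i using Fin.cases with
    | zero => simp [hw0]
    | succ i =>
      have hvi := congrFun (smul_affinePoint hv0) i
      have hwi := congrFun (smul_affinePoint hw0) i
      simp only [Fin.tail, Pi.smul_apply, smul_eq_mul] at hvi hwi
      rw [Pi.smul_apply, smul_eq_mul, ← hvi, ← hwi, hz]
      field_simp

theorem continuous_graphExt (hcont : Continuous ξ)
    (hlim : Tendsto ξ (cocompact (Fin 3 → ℂ)) (nhds ![1, 0, 0, 0])) :
    Continuous (graphExt hnz) := by
  refine (Projectivization.isOpenQuotientMap_mk' ℂ (Fin 4 → ℂ)).isQuotientMap.continuous_iff.2 ?_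
  refine (Projectivization.isOpenQuotientMap_mk' ℂ _).continuous.comp
    (Continuous.subtype_mk (f := fun v : {v : Fin 4 → ℂ // v ≠ 0} ↦ graphLift ξ v) ?_ _)
  exact continuous_iff_continuousAt.2 fun v ↦
    (continuousAt_graphLift ξ hcont hlim v.2).comp continuous_subtype_val.continuousAt

theorem range_graphG_subset : Set.range (graphG ξ hnz) ⊆ Set.range (graphExt hnz) := by
  rintro _ ⟨z, rfl⟩
  have h : (Fin.cons 1 z : Fin 4 → ℂ) ≠ 0 := fun h ↦ one_ne_zero (congrFun h 0)
  refine ⟨Projectivization.mk ℂ _ h, ?_⟩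
  rw [graphExt_mk_of_ne_zero hnz h (by simp), affinePoint_cons_one]

theorem range_graphExt : Set.range (graphExt hnz) = Set.range (graphG ξ hnz) ∪
    {p | ∃ W : Fin 4 → ℂ, ∃ hW : W ≠ 0, W 0 = 0 ∧
      p = Projectivization.mk ℂ ((0 : Fin 4 → ℂ), W) (fun h => hW (congrArg Prod.snd h))} := by
  refine Set.Subset.antisymm ?_ (Set.union_subset (range_graphG_subset hnz) ?_)
  · rintro _ ⟨p, rfl⟩
    induction p using Projectivization.ind with | h v hv => ?_
    by_cases hv0 : v 0 = 0
    · have hl := graphLift_of_eq_zero ξ hv0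
      refine Or.inr ⟨![0, v 3, v 2, v 1], fun h ↦ graphLift_ne_zero hnz hv ?_, rfl, ?_⟩
      · rw [hl, h, Prod.mk_zero_zero]
      · simp only [graphExt_mk, hl]
    · exact Or.inl ⟨_, (graphExt_mk_of_ne_zero hnz hv hv0).symm⟩
  · rintro _ ⟨W, hW, hW0, rfl⟩
    have hv : ![0, W 3, W 2, W 1] ≠ 0 := by
      contrapose! hW
      ext i
      fin_cases i
      · exact hW0
      · exact congrFun hW 3
      · exact congrFun hW 2
      · exact congrFun hW 1
    refine ⟨Projectivization.mk ℂ _ hv, ?_⟩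
    have hl : graphLift ξ ![0, W 3, W 2, W 1] = (0, W) := by
      rw [graphLift_of_eq_zero ξ rfl]
      congr 1
      ext i
      fin_cases i <;> simp [hW0]
    simp only [graphExt_mk, hl]

theorem isClosedEmbedding_graphExt (hcont : Continuous ξ)
    (hlim : Tendsto ξ (cocompact (Fin 3 → ℂ)) (nhds ![1, 0, 0, 0])) :
    Topology.IsClosedEmbedding (graphExt hnz) :=
  (continuous_graphExt hnz hcont hlim).isClosedEmbedding (graphExt_injective hnz)

theorem closure_range_graphG (hcont : Continuous ξ)
    (hlim : Tendsto ξ (cocompact (Fin 3 → ℂ)) (nhds ![1, 0, 0, 0])) :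
    closure (Set.range (graphG ξ hnz)) = Set.range (graphExt hnz) := by
  refine Set.Subset.antisymm (closure_minimal (range_graphG_subset hnz)
    (isClosedEmbedding_graphExt hnz hcont hlim).isClosed_range) ?_
  have hq := Projectivization.isOpenQuotientMap_mk' ℂ (Fin 4 → ℂ)
  have hdense : Dense ((fun v : {v : Fin 4 → ℂ // v ≠ 0} ↦ v.1 0) ⁻¹' {0}ᶜ) :=
    (dense_compl_singleton (0 : ℂ)).preimage
      ((isOpenMap_eval 0).comp isOpen_ne.isOpenMap_subtype_val)
  rw [← hq.surjective.range_comp]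
  refine (((continuous_graphExt hnz hcont hlim).comp hq.continuous).range_subset_closure_image_dense
    hdense).trans (closure_mono ?_)
  rintro _ ⟨v, hv, rfl⟩
  exact ⟨_, (graphExt_mk_of_ne_zero hnz v.2 hv).symm⟩

end Lift

/-- **Closure of an asymptotically standard twistor graph.** If `ξ` is continuous,
nowhere zero and tends to `(1,0,0,0)` at infinity, then the closure of the image of the
twistor graph `G` adds exactly the projective plane `{[(0,W)] : W ≠ 0, W₁ = 0}` in the
fiber over infinity; moreover this closure is homeomorphic to `ℙ³(ℂ)`. -/
theorem closure_of_asymptotically_standard_graph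
    (ξ : (Fin 3 → ℂ) → (Fin 4 → ℂ)) (hcont : Continuous ξ) (hnz : ∀ z, ξ z ≠ 0)
    (hlim : Tendsto ξ (cocompact (Fin 3 → ℂ)) (nhds ![1, 0, 0, 0])) :
    closure (Set.range (graphG ξ hnz))
      = Set.range (graphG ξ hnz) ∪
        {p | ∃ W : Fin 4 → ℂ, ∃ hW : W ≠ 0, W 0 = 0 ∧
          p = Projectivization.mk ℂ ((0 : Fin 4 → ℂ), W)
                (fun h => hW (congrArg Prod.snd h))} ∧
    Nonempty (↥(closure (Set.range (graphG ξ hnz))) ≃ₜ Projectivization ℂ (Fin 4 → ℂ)) := by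
  have h := closure_range_graphG hnz hcont hlim
  exact ⟨h.trans (range_graphExt hnz),
    ⟨(Homeomorph.setCongr h).trans
      (isClosedEmbedding_graphExt hnz hcont hlim).isEmbedding.toHomeomorph.symm⟩⟩
end
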